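/- Assume the standard setup with r ≥ 2, and suppose c_{j−1} ≤ e < c_j for some 3 ≤ j ≤ r. Let 1 ≤ i ≤ j − 1 and assume e + s·nᵢ ≥ c_r, where s ≥ 1 if nᵢ = 1 and s ≥ 2 is even if nᵢ ≥ 2. If Vᵢ contains a pendant vertex, then s·nᵢ + t − r + b ≤ χ_la(G(Vᵢ,s)) ≤ s·nᵢ + t − r + j − 1. -/

import Mathlib

open Finset
open scoped Classical

namespace LocalAntimagic

variable {V : Type*}

/-- The induced vertex label: sum of the labels of edges incident to `v`. -/
noncomputable def vertexSum [Fintype V] (G : SimpleGraph V) (f : Sym2 V → ℕ) (v : V) : ℕ :=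
  ∑ e ∈ G.incidenceFinset v, f e

/-- `f` is a local antimagic labeling of `G`: a bijection from the edge set onto
`{1, …, |E|}` whose induced vertex labels distinguish adjacent vertices. -/
def IsLocalAntimagic [Fintype V] (G : SimpleGraph V) (f : Sym2 V → ℕ) : Prop :=
  Set.BijOn f G.edgeSet (Set.Icc 1 G.edgeFinset.card) ∧
  ∀ ⦃u v : V⦄, G.Adj u v → vertexSum G f u ≠ vertexSum G f v

/-- The color number `c(f)`: the number of distinct induced vertex labels. -/
noncomputable def colorCount [Fintype V] (G : SimpleGraph V) (f : Sym2 V → ℕ) : ℕ :=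
  (Finset.univ.image (vertexSum G f)).card

/-- The local antimagic chromatic number. -/
noncomputable def chiLA [Fintype V] (G : SimpleGraph V) : ℕ :=
  sInf {n | ∃ f, IsLocalAntimagic G f ∧ colorCount G f = n}

/-- A pendant vertex is a vertex of degree 1. -/
def IsPendant [Fintype V] (G : SimpleGraph V) (v : V) : Prop :=
  G.degree v = 1

/-- The number of pendant vertices of `G`. -/
noncomputable def pendantCount [Fintype V] (G : SimpleGraph V) : ℕ :=
  (Finset.univ.filter (fun v => IsPendant G v)).card

/-- `G(S, s)`: the graph obtained from `G` by attaching `s` new pendant edges to every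
vertex of `S`.  The new pendant vertex attached to `w ∈ S` via the `j`-th new edge is
`Sum.inr (w, j)`; the original graph lives on the `Sum.inl` vertices. -/
def attachPendants (G : SimpleGraph V) (S : Finset V) (s : ℕ) :
    SimpleGraph (V ⊕ (S × Fin s)) :=
  SimpleGraph.fromRel (fun a b =>
    (∃ u v : V, a = Sum.inl u ∧ b = Sum.inl v ∧ G.Adj u v) ∨
    (∃ (w : S) (j : Fin s), a = Sum.inl (w : V) ∧ b = Sum.inr (w, j)))

/-- The standard setup: `G` is a connected graph with at least `2` edges and
`χ_la(G) = t ≥ 2`; `f` is a local antimagic labeling of `G` with `c(f) = t` whose color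
classes are `Vset 1, …, Vset t` (each nonempty, with `f⁺ ≡ c i` on `Vset i`, and the
colors `c 1, …, c t` pairwise distinct); every non-pendant vertex lies in
`Vset 1 ∪ ⋯ ∪ Vset r` where `1 ≤ r ≤ t`; each `Vset i` with `r + 1 ≤ i ≤ t` is a
singleton consisting of a pendant vertex; `c 1 < c 2 < ⋯ < c r` and
`c (r+1) < c (r+2) < ⋯ < c t`. -/
structure StandardSetup [Fintype V] (G : SimpleGraph V) (f : Sym2 V → ℕ)
    (t r : ℕ) (Vset : ℕ → Finset V) (c : ℕ → ℕ) : Prop where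
  connected : G.Connected
  two_le_card_edges : 2 ≤ G.edgeFinset.card
  chiLA_eq : chiLA G = t
  two_le_t : 2 ≤ t
  antimagic : IsLocalAntimagic G f
  colorCount_eq : colorCount G f = t
  color_on_class : ∀ i ∈ Finset.Icc 1 t, ∀ v ∈ Vset i, vertexSum G f v = c i
  class_cover : ∀ v : V, ∃ i ∈ Finset.Icc 1 t, v ∈ Vset i
  class_nonempty : ∀ i ∈ Finset.Icc 1 t, (Vset i).Nonempty
  color_injective : ∀ i ∈ Finset.Icc 1 t, ∀ j ∈ Finset.Icc 1 t, i ≠ j → c i ≠ c j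
  one_le_r : 1 ≤ r
  r_le_t : r ≤ t
  nonpendant_mem : ∀ v : V, ¬ IsPendant G v → ∃ i ∈ Finset.Icc 1 r, v ∈ Vset i
  pendant_singleton : ∀ i ∈ Finset.Icc (r + 1) t, ∃ v : V, IsPendant G v ∧ Vset i = {v}
  c_strictMono_low : ∀ i j : ℕ, 1 ≤ i → i < j → j ≤ r → c i < c j
  c_strictMono_high : ∀ i j : ℕ, r + 1 ≤ i → i < j → j ≤ t → c i < c j

/-- `b`: the number of pendant vertices of `G` lying in `Vset 1 ∪ ⋯ ∪ Vset r`. -/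
noncomputable def pendantsInLow [Fintype V] (G : SimpleGraph V)
    (Vset : ℕ → Finset V) (r : ℕ) : ℕ :=
  (((Finset.Icc 1 r).biUnion Vset).filter (fun v => IsPendant G v)).card

section VertexSum

variable [Fintype V] {G : SimpleGraph V} {f : Sym2 V → ℕ}

theorem vertexSum_eq_sum_neighborFinset (G : SimpleGraph V) (f : Sym2 V → ℕ) (v : V) :
    vertexSum G f v = ∑ w ∈ G.neighborFinset v, f s(v, w) := by
  unfold vertexSum
  symm
  refine Finset.sum_bij (fun w _ => s(v, w)) ?_ ?_ ?_ ?_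
  · intro w hw
    simpa [SimpleGraph.mk'_mem_incidenceSet_iff] using hw
  · intro a _ b _ h
    exact Sym2.congr_right.1 h
  · intro x hx
    rw [SimpleGraph.mem_incidenceFinset] at hx
    obtain ⟨hx, w, rfl⟩ := hx
    exact ⟨w, by simpa using hx, rfl⟩
  · intros
    rfl

theorem vertexSum_eq_sum_ite (G : SimpleGraph V) (f : Sym2 V → ℕ) (v : V) :
    vertexSum G f v = ∑ w, if G.Adj v w then f s(v, w) else 0 := by
  rw [vertexSum_eq_sum_neighborFinset, ← Finset.sum_filter]
  congr 1
  ext w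
  simp

theorem vertexSum_one (G : SimpleGraph V) (v : V) :
    vertexSum G (fun _ => 1) v = G.degree v := by
  rw [vertexSum_eq_sum_neighborFinset]
  simp

theorem IsPendant.exists_vertexSum_eq {v : V} (hv : IsPendant G v) :
    ∃ w, G.Adj v w ∧ ∀ h : Sym2 V → ℕ, vertexSum G h v = h s(v, w) := by
  unfold IsPendant SimpleGraph.degree at hv
  obtain ⟨w, hw⟩ := Finset.card_eq_one.1 hv
  refine ⟨w, ?_, fun h => ?_⟩
  · rw [← SimpleGraph.mem_neighborFinset, hw]
    simp
  · rw [vertexSum_eq_sum_neighborFinset, hw, Finset.sum_singleton]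

namespace IsLocalAntimagic

theorem label_mem {u v : V} (hf : IsLocalAntimagic G f) (h : G.Adj u v) :
    1 ≤ f s(u, v) ∧ f s(u, v) ≤ G.edgeFinset.card :=
  hf.1.mapsTo (G.mem_edgeSet.2 h)

theorem vertexSum_pendant_mem {v : V} (hf : IsLocalAntimagic G f) (hv : IsPendant G v) :
    1 ≤ vertexSum G f v ∧ vertexSum G f v ≤ G.edgeFinset.card := by
  obtain ⟨w, hw, h⟩ := hv.exists_vertexSum_eq
  rw [h]
  exact hf.label_mem hw

theorem not_isPendant_of_adj {u v : V} (hf : IsLocalAntimagic G f) (h : G.Adj u v)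
    (hu : IsPendant G u) : ¬ IsPendant G v := by
  intro hv
  obtain ⟨w, hw, hw'⟩ := hu.exists_vertexSum_eq
  obtain ⟨x, hx, hx'⟩ := hv.exists_vertexSum_eq
  have key : ∀ {a b c : V}, IsPendant G a → G.Adj a b → G.Adj a c → b = c := by
    intro a b c ha hb hc
    exact Finset.card_le_one.1 (le_of_eq ha) _ ((G.mem_neighborFinset a b).2 hb) _
      ((G.mem_neighborFinset a c).2 hc)
  obtain rfl := key hu h hw
  obtain rfl := key hv h.symm hx
  exact hf.2 h (by rw [hw', hx', Sym2.eq_swap])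

theorem injOn_vertexSum_pendant (hf : IsLocalAntimagic G f) :
    Set.InjOn (vertexSum G f) {v | IsPendant G v} := by
  intro u hu v hv huv
  obtain ⟨w, hw, hw'⟩ := IsPendant.exists_vertexSum_eq hu
  obtain ⟨x, hx, hx'⟩ := IsPendant.exists_vertexSum_eq hv
  rw [hw', hx'] at huv
  have := hf.1.injOn (G.mem_edgeSet.2 hw) (G.mem_edgeSet.2 hx) huv
  rcases Sym2.eq_iff.1 this with h | ⟨rfl, rfl⟩
  · exact h.1
  · exact absurd hv (hf.not_isPendant_of_adj hw hu)

theorem exists_card_lt_vertexSum (hf : IsLocalAntimagic G f) (hG : 1 ≤ G.edgeFinset.card) :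
    ∃ v, G.edgeFinset.card < vertexSum G f v := by
  obtain ⟨x, hx, hxm⟩ := hf.1.surjOn (Set.right_mem_Icc.2 hG)
  have key : ∀ {u v : V}, G.Adj u v → ¬ IsPendant G u → f s(u, v) < vertexSum G f u := by
    intro u v h hu
    have hv : v ∈ G.neighborFinset u := by simpa using h
    obtain ⟨w, hw, hwv⟩ : ∃ w ∈ G.neighborFinset u, w ≠ v := by
      by_contra! hc
      exact hu (Finset.card_eq_one.2 ⟨v, Finset.eq_singleton_iff_unique_mem.2 ⟨hv, hc⟩⟩)
    rw [vertexSum_eq_sum_neighborFinset, ← Finset.add_sum_erase _ _ hv]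
    have h1 : f s(u, w) ≤ ∑ z ∈ (G.neighborFinset u).erase v, f s(u, z) :=
      Finset.single_le_sum (f := fun z => f s(u, z)) (fun _ _ => Nat.zero_le _)
        (Finset.mem_erase.2 ⟨hwv, hw⟩)
    have := (hf.label_mem ((G.mem_neighborFinset u w).1 hw)).1
    lia
  induction x with | h u v => ?_
  rw [SimpleGraph.mem_edgeSet] at hx
  by_cases hu : IsPendant G u
  · exact ⟨v, by rw [← hxm, Sym2.eq_swap]; exact key hx.symm (hf.not_isPendant_of_adj hx hu)⟩
  · exact ⟨u, by rw [← hxm]; exact key hx hu⟩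

theorem pendantCount_lt_colorCount (hf : IsLocalAntimagic G f)
    (hG : 1 ≤ G.edgeFinset.card) : pendantCount G < colorCount G f := by
  obtain ⟨v, hv⟩ := hf.exists_card_lt_vertexSum hG
  set P := Finset.univ.filter (fun v => IsPendant G v) with hP
  have hinj : Set.InjOn (vertexSum G f) P := hf.injOn_vertexSum_pendant.mono (by intro; simp [hP])
  unfold pendantCount colorCount
  rw [← hP, ← Finset.card_image_of_injOn hinj]
  refine Finset.card_lt_card (Finset.ssubset_iff_of_subset
    (Finset.image_subset_image (Finset.subset_univ _)) |>.2
    ⟨vertexSum G f v, Finset.mem_image_of_mem _ (Finset.mem_univ _), ?_⟩)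
  intro h
  obtain ⟨w, hw, hwv⟩ := Finset.mem_image.1 h
  have := (hf.vertexSum_pendant_mem (v := w) (by simpa [hP] using hw)).2
  lia

end IsLocalAntimagic

end VertexSum

section AttachPendants

variable {G : SimpleGraph V} {S : Finset V} {s : ℕ}

@[simp]
theorem attachPendants_adj_inl_inl {u v : V} :
    (attachPendants G S s).Adj (Sum.inl u) (Sum.inl v) ↔ G.Adj u v := by
  simp only [attachPendants, SimpleGraph.fromRel_adj]
  constructor
  · rintro ⟨_, (⟨a, b, h₁, h₂, h⟩ | ⟨a, b, h₁, h₂⟩) | (⟨a, b, h₁, h₂, h⟩ | ⟨a, b, h₁, h₂⟩)⟩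
    · cases h₁; cases h₂; exact h
    · cases h₂
    · cases h₁; cases h₂; exact h.symm
    · cases h₂
  · intro h
    exact ⟨by simpa using h.ne, Or.inl (Or.inl ⟨u, v, rfl, rfl, h⟩)⟩

@[simp]
theorem attachPendants_adj_inl_inr {v : V} {p : S × Fin s} :
    (attachPendants G S s).Adj (Sum.inl v) (Sum.inr p) ↔ (p.1 : V) = v := by
  simp only [attachPendants, SimpleGraph.fromRel_adj]
  constructor
  · rintro ⟨_, (⟨a, b, h₁, h₂, h⟩ | ⟨a, b, h₁, h₂⟩) | (⟨a, b, h₁, h₂, h⟩ | ⟨a, b, h₁, h₂⟩)⟩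
    · cases h₂
    · cases h₁; cases h₂; rfl
    · cases h₁
    · cases h₁
  · rintro rfl
    exact ⟨by simp, Or.inl (Or.inr ⟨p.1, p.2, rfl, rfl⟩)⟩

@[simp]
theorem attachPendants_adj_inr_inl {v : V} {p : S × Fin s} :
    (attachPendants G S s).Adj (Sum.inr p) (Sum.inl v) ↔ (p.1 : V) = v := by
  rw [SimpleGraph.adj_comm, attachPendants_adj_inl_inr]

@[simp]
theorem not_attachPendants_adj_inr_inr {p q : S × Fin s} :
    ¬ (attachPendants G S s).Adj (Sum.inr p) (Sum.inr q) := by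
  simp [attachPendants, SimpleGraph.fromRel_adj]

theorem mem_edgeSet_attachPendants {x : Sym2 (V ⊕ (S × Fin s))} :
    x ∈ (attachPendants G S s).edgeSet ↔
      (∃ u v, G.Adj u v ∧ x = s(Sum.inl u, Sum.inl v)) ∨
        ∃ p : S × Fin s, x = s(Sum.inl (p.1 : V), Sum.inr p) := by
  constructor
  · induction x with | h a b => ?_
    rcases a with u | p <;> rcases b with v | q <;> rw [SimpleGraph.mem_edgeSet]
    · intro h
      exact Or.inl ⟨u, v, by simpa using h, rfl⟩
    · intro h
      rw [attachPendants_adj_inl_inr] at h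
      exact Or.inr ⟨q, by rw [h]⟩
    · intro h
      rw [attachPendants_adj_inr_inl] at h
      exact Or.inr ⟨p, by rw [h, Sym2.eq_swap]⟩
    · intro h
      exact absurd h not_attachPendants_adj_inr_inr
  · rintro (⟨u, v, h, rfl⟩ | ⟨p, rfl⟩)
    · simpa using h
    · simp

/-- The labeling of `attachPendants G S s` that agrees with `f` on the edges of `G` and gives
the new edge ending at the new vertex `p` the label `L p`. -/
def extendLabeling (f : Sym2 V → ℕ) (L : S × Fin s → ℕ) : Sym2 (V ⊕ (S × Fin s)) → ℕ :=
  Sym2.lift ⟨fun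
    | Sum.inl u, Sum.inl v => f s(u, v)
    | Sum.inl _, Sum.inr p => L p
    | Sum.inr p, Sum.inl _ => L p
    | Sum.inr _, Sum.inr _ => 0, by
      rintro (u | p) (v | q) <;> simp [Sym2.eq_swap]⟩

@[simp]
theorem extendLabeling_inl_inl (f : Sym2 V → ℕ) (L : S × Fin s → ℕ) (u v : V) :
    extendLabeling f L s(Sum.inl u, Sum.inl v) = f s(u, v) := rfl

@[simp]
theorem extendLabeling_inl_inr (f : Sym2 V → ℕ) (L : S × Fin s → ℕ) (u : V) (p : S × Fin s) :
    extendLabeling f L s(Sum.inl u, Sum.inr p) = L p := rfl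

@[simp]
theorem extendLabeling_inr_inl (f : Sym2 V → ℕ) (L : S × Fin s → ℕ) (u : V) (p : S × Fin s) :
    extendLabeling f L s(Sum.inr p, Sum.inl u) = L p := rfl

theorem bijOn_extendLabeling {f : Sym2 V → ℕ} {L : S × Fin s → ℕ} {e m : ℕ}
    (hf : Set.BijOn f G.edgeSet (Set.Icc 1 e))
    (hL : Set.BijOn L Set.univ (Set.Icc (e + 1) (e + m))) :
    Set.BijOn (extendLabeling f L) (attachPendants G S s).edgeSet (Set.Icc 1 (e + m)) := by
  have hfm : ∀ {u v}, G.Adj u v → 1 ≤ f s(u, v) ∧ f s(u, v) ≤ e :=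
    fun h => hf.mapsTo (G.mem_edgeSet.2 h)
  have hLm : ∀ p, e + 1 ≤ L p ∧ L p ≤ e + m := fun p => hL.mapsTo (Set.mem_univ p)
  refine ⟨?_, ?_, ?_⟩
  · intro x hx
    rcases mem_edgeSet_attachPendants.1 hx with ⟨u, v, h, rfl⟩ | ⟨p, rfl⟩
    · have := hfm h
      exact ⟨this.1, by rw [extendLabeling_inl_inl]; lia⟩
    · have := hLm p
      exact ⟨by rw [extendLabeling_inl_inr]; lia, this.2⟩
  · intro x hx y hy hxy
    rcases mem_edgeSet_attachPendants.1 hx with ⟨u, v, h, rfl⟩ | ⟨p, rfl⟩ <;>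
    rcases mem_edgeSet_attachPendants.1 hy with ⟨u', v', h', rfl⟩ | ⟨q, rfl⟩ <;>
    simp only [extendLabeling_inl_inl, extendLabeling_inl_inr] at hxy
    · have := hf.injOn (G.mem_edgeSet.2 h) (G.mem_edgeSet.2 h') hxy
      exact congrArg (Sym2.map Sum.inl) this
    · have := hfm h
      have := hLm q
      lia
    · have := hfm h'
      have := hLm p
      lia
    · rw [hL.injOn (Set.mem_univ p) (Set.mem_univ q) hxy]
  · rintro k ⟨hk₁, hk₂⟩
    by_cases hk : k ≤ e
    · obtain ⟨x, hx, rfl⟩ := hf.surjOn ⟨hk₁, hk⟩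
      induction x with | h u v => ?_
      exact ⟨s(Sum.inl u, Sum.inl v), by simpa using hx, rfl⟩
    · obtain ⟨p, _, rfl⟩ := hL.surjOn (a := k) ⟨by lia, hk₂⟩
      exact ⟨s(Sum.inl (p.1 : V), Sum.inr p), by simp, rfl⟩

variable [Fintype V]

theorem vertexSum_attachPendants_inl (h : Sym2 (V ⊕ (S × Fin s)) → ℕ) (v : V) :
    vertexSum (attachPendants G S s) h (Sum.inl v) =
      (∑ w, if G.Adj v w then h s(Sum.inl v, Sum.inl w) else 0) +
        ∑ p : S × Fin s, if (p.1 : V) = v then h s(Sum.inl v, Sum.inr p) else 0 := by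
  rw [vertexSum_eq_sum_ite, Fintype.sum_sum_type]
  simp

theorem vertexSum_attachPendants_inr (h : Sym2 (V ⊕ (S × Fin s)) → ℕ) (p : S × Fin s) :
    vertexSum (attachPendants G S s) h (Sum.inr p) = h s(Sum.inr p, Sum.inl (p.1 : V)) := by
  rw [vertexSum_eq_sum_ite, Fintype.sum_sum_type]
  simp

theorem vertexSum_extendLabeling_of_notMem (f : Sym2 V → ℕ) (L : S × Fin s → ℕ) {v : V}
    (hv : v ∉ S) :
    vertexSum (attachPendants G S s) (extendLabeling f L) (Sum.inl v) = vertexSum G f v := by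
  have : ∀ p : S × Fin s, (p.1 : V) ≠ v := by
    rintro p rfl
    exact hv p.1.2
  rw [vertexSum_attachPendants_inl, vertexSum_eq_sum_ite]
  simp [this]

theorem vertexSum_extendLabeling_of_mem (f : Sym2 V → ℕ) (L : S × Fin s → ℕ) {v : V}
    (hv : v ∈ S) :
    vertexSum (attachPendants G S s) (extendLabeling f L) (Sum.inl v) =
      vertexSum G f v + ∑ k, L (⟨v, hv⟩, k) := by
  rw [vertexSum_attachPendants_inl, vertexSum_eq_sum_ite, Fintype.sum_prod_type]
  congr 1
  rw [Finset.sum_eq_single (⟨v, hv⟩ : S)]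
  · simp
  · intro w _ hw
    have : (w : V) ≠ v := fun h => hw (Subtype.ext h)
    simp [this]
  · simp

theorem isPendant_attachPendants_inr (p : S × Fin s) :
    IsPendant (attachPendants G S s) (Sum.inr p) := by
  unfold IsPendant
  rw [← vertexSum_one, vertexSum_attachPendants_inr]

theorem IsPendant.attachPendants_inl {v : V} (hv : IsPendant G v) (hvS : v ∉ S) :
    IsPendant (attachPendants G S s) (Sum.inl v) := by
  have : ∀ p : S × Fin s, (p.1 : V) ≠ v := by
    rintro p rfl
    exact hvS p.1.2
  unfold IsPendant at hv ⊢
  rw [← vertexSum_one, vertexSum_eq_sum_ite] at hv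
  rw [← vertexSum_one, vertexSum_attachPendants_inl, hv]
  simp [this]

theorem le_pendantCount_attachPendants (G : SimpleGraph V) (S : Finset V) (s : ℕ) :
    s * S.card + (Finset.univ.filter (fun v => IsPendant G v ∧ v ∉ S)).card ≤
      pendantCount (attachPendants G S s) := by
  have hcard : s * S.card = (Finset.univ : Finset (S × Fin s)).card := by
    simp [mul_comm]
  rw [hcard, add_comm, ← Finset.card_disjSum]
  refine Finset.card_le_card ?_
  rintro (v | p) hx
  · rw [Finset.inl_mem_disjSum, Finset.mem_filter] at hx
    exact Finset.mem_filter.2 ⟨Finset.mem_univ _, hx.2.1.attachPendants_inl hx.2.2⟩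
  · exact Finset.mem_filter.2 ⟨Finset.mem_univ _, isPendant_attachPendants_inr p⟩

/-- Extending a local antimagic labeling by labels with constant row sums `C` on the new edges
yields a local antimagic labeling, as soon as the old colors off `S` stay within the new labels. -/
theorem IsLocalAntimagic.extendLabeling {f : Sym2 V → ℕ} {L : S × Fin s → ℕ} {m c C : ℕ}
    (hf : IsLocalAntimagic G f)
    (hL : Set.BijOn L Set.univ (Set.Icc (G.edgeFinset.card + 1) (G.edgeFinset.card + m)))
    (hC : ∀ w, ∑ k, L (w, k) = C) (hc : ∀ v ∈ S, vertexSum G f v = c)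
    (hcC : G.edgeFinset.card + m < c + C)
    (hS : ∀ v ∉ S, vertexSum G f v ≤ G.edgeFinset.card + m) :
    IsLocalAntimagic (attachPendants G S s) (extendLabeling f L) := by
  have hbij := bijOn_extendLabeling (G := G) hf.1 hL
  have hcard : (attachPendants G S s).edgeFinset.card = G.edgeFinset.card + m := by
    have h := hbij.image_eq
    have h' := hbij.injOn.ncard_image
    rw [h, ← SimpleGraph.coe_edgeFinset, Set.ncard_coe_finset, ← Finset.coe_Icc,
      Set.ncard_coe_finset, Nat.card_Icc] at h'
    lia
  have hmem : ∀ v ∈ S, vertexSum (attachPendants G S s) (LocalAntimagic.extendLabeling f L)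
      (Sum.inl v) = c + C := by
    intro v hv
    rw [vertexSum_extendLabeling_of_mem f L hv, hc v hv, hC]
  have hnew : ∀ p : S × Fin s, vertexSum (attachPendants G S s)
      (LocalAntimagic.extendLabeling f L) (Sum.inr p) < c + C := by
    intro p
    rw [vertexSum_attachPendants_inr, extendLabeling_inr_inl]
    have := (hL.mapsTo (Set.mem_univ p)).2
    lia
  refine ⟨by rwa [hcard], ?_⟩
  rintro (u | p) (v | q) h
  · rw [attachPendants_adj_inl_inl] at h
    by_cases hu : u ∈ S <;> by_cases hv : v ∈ S
    · exact absurd ((hc u hu).trans (hc v hv).symm) (hf.2 h)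
    · have := hS v hv
      rw [hmem u hu, vertexSum_extendLabeling_of_notMem f L hv]
      lia
    · have := hS u hu
      rw [hmem v hv, vertexSum_extendLabeling_of_notMem f L hu]
      lia
    · rw [vertexSum_extendLabeling_of_notMem f L hu, vertexSum_extendLabeling_of_notMem f L hv]
      exact hf.2 h
  · rw [attachPendants_adj_inl_inr] at h
    subst h
    rw [hmem _ q.1.2]
    exact (hnew q).ne'
  · rw [attachPendants_adj_inr_inl] at h
    subst h
    rw [hmem _ p.1.2]
    exact (hnew p).ne
  · exact absurd h not_attachPendants_adj_inr_inr

end AttachPendants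

section SnakeLabel

/-- The entry in row `a` and column `k` of the array with `n` rows whose columns list
consecutive integers, alternately downwards and upwards. -/
def snakeLabel (n a k : ℕ) : ℕ :=
  k * n + if Even k then a else n - 1 - a

theorem snakeLabel_lt {n a k s : ℕ} (ha : a < n) (hk : k < s) : snakeLabel n a k < s * n := by
  have h : (k + 1) * n ≤ s * n := Nat.mul_le_mul_right n hk
  rw [add_mul, one_mul] at h
  unfold snakeLabel
  split_ifs <;> lia

theorem snakeLabel_injective {n a k a' k' : ℕ} (ha : a < n) (ha' : a' < n)
    (h : snakeLabel n a k = snakeLabel n a' k') : a = a' ∧ k = k' := by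
  have hdiv : ∀ {a k : ℕ}, a < n → snakeLabel n a k / n = k := by
    intro a k ha
    unfold snakeLabel
    rw [mul_comm, Nat.mul_add_div (by lia), Nat.div_eq_of_lt (by split_ifs <;> lia), add_zero]
  have hk : k = k' := by rw [← hdiv ha (k := k), h, hdiv ha']
  subst hk
  refine ⟨?_, rfl⟩
  unfold snakeLabel at h
  split_ifs at h <;> lia

theorem sum_snakeLabel_eq {n a a' : ℕ} (ha : a < n) (ha' : a' < n) (m : ℕ) :
    ∑ k ∈ Finset.range (2 * m), snakeLabel n a k =
      ∑ k ∈ Finset.range (2 * m), snakeLabel n a' k := by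
  induction m with
  | zero => simp
  | succ m ih =>
    rw [mul_add, mul_one, Finset.sum_range_succ, Finset.sum_range_succ, Finset.sum_range_succ,
      Finset.sum_range_succ, ih]
    have h₁ : Even (2 * m) := even_two_mul m
    have h₂ : ¬ Even (2 * m + 1) := by simp
    simp only [snakeLabel, h₁, h₂, if_true, if_false]
    lia

/-- Consecutive integers can be arranged in an `n × s` array with constant row sums when
`n = 1` or `s` is even. -/
theorem exists_bijOn_constant_row_sum (S : Finset V) (s e : ℕ) (hs : S.card = 1 ∨ Even s) :
    ∃ L : S × Fin s → ℕ, Set.BijOn L Set.univ (Set.Icc (e + 1) (e + s * S.card)) ∧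
      ∀ w w', ∑ k, L (w, k) = ∑ k, L (w', k) := by
  let φ := S.equivFin
  let L : S × Fin s → ℕ := fun p => e + 1 + snakeLabel S.card (φ p.1) p.2
  have hmaps : ∀ p, L p ∈ Finset.Icc (e + 1) (e + s * S.card) := by
    intro p
    have := snakeLabel_lt (φ p.1).2 p.2.2
    simp only [L, Finset.mem_Icc]
    lia
  have hinj : Function.Injective L := by
    intro p q h
    obtain ⟨h₁, h₂⟩ := snakeLabel_injective (φ p.1).2 (φ q.1).2 (Nat.add_left_cancel h)
    exact Prod.ext (φ.injective (Fin.ext h₁)) (Fin.ext h₂)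
  have himage : Finset.univ.image L = Finset.Icc (e + 1) (e + s * S.card) := by
    refine Finset.eq_of_subset_of_card_le (by simpa [Finset.image_subset_iff] using hmaps) ?_
    rw [Finset.card_image_of_injective _ hinj, Nat.card_Icc]
    simp [mul_comm]
  refine ⟨L, ⟨fun p _ => by simpa using hmaps p, hinj.injOn, ?_⟩, ?_⟩
  · intro k hk
    rw [← Finset.coe_Icc, ← himage] at hk
    simpa using hk
  · intro w w'
    rcases hs with hs | ⟨m, rfl⟩
    · rw [Subtype.ext (Finset.card_le_one.1 hs.le _ w.2 _ w'.2)]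
    · simp only [L, Finset.sum_add_distrib]
      rw [Fin.sum_univ_eq_sum_range (fun k => snakeLabel S.card (φ w) k),
        Fin.sum_univ_eq_sum_range (fun k => snakeLabel S.card (φ w') k), ← two_mul,
        sum_snakeLabel_eq (φ w).2 (φ w').2]

end SnakeLabel

section StandardSetup

variable [Fintype V] {G : SimpleGraph V} {f : Sym2 V → ℕ} {t r : ℕ} {Vset : ℕ → Finset V}
  {c : ℕ → ℕ}

namespace StandardSetup

theorem index_eq (setup : StandardSetup G f t r Vset c) {k l : ℕ} (hk : k ∈ Finset.Icc 1 t)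
    (hl : l ∈ Finset.Icc 1 t) {v w : V} (hv : v ∈ Vset k) (hw : w ∈ Vset l)
    (h : vertexSum G f v = vertexSum G f w) : k = l := by
  by_contra hne
  rw [setup.color_on_class k hk v hv, setup.color_on_class l hl w hw] at h
  exact setup.color_injective k hk l hl hne h

theorem color_high_le (setup : StandardSetup G f t r Vset c) {k : ℕ}
    (hk : k ∈ Finset.Icc (r + 1) t) : c k ≤ G.edgeFinset.card := by
  obtain ⟨v, hv, hvk⟩ := setup.pendant_singleton k hk
  have hk' : k ∈ Finset.Icc 1 t := by
    rw [Finset.mem_Icc] at hk ⊢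
    lia
  rw [← setup.color_on_class k hk' v (by simp [hvk])]
  exact (setup.antimagic.vertexSum_pendant_mem hv).2

theorem color_le (setup : StandardSetup G f t r Vset c) {k : ℕ} (hk : k ∈ Finset.Icc 1 r) :
    c k ≤ c r := by
  rw [Finset.mem_Icc] at hk
  rcases hk.2.eq_or_lt with rfl | h
  · rfl
  · exact (setup.c_strictMono_low k r hk.1 h le_rfl).le

theorem pendantsInLow_add_le_pendantCount (setup : StandardSetup G f t r Vset c) :
    pendantsInLow G Vset r + (t - r) ≤ pendantCount G := by
  let low := ((Finset.Icc 1 r).biUnion Vset).filter (fun v => IsPendant G v)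
  let P := Finset.univ.filter (fun v => IsPendant G v)
  have hlow : low ⊆ P := by
    intro v hv
    simp only [low, P, Finset.mem_filter] at hv ⊢
    exact ⟨Finset.mem_univ v, hv.2⟩
  have hhigh : (Finset.Icc (r + 1) t).image c ⊆ (P \ low).image (vertexSum G f) := by
    intro x hx
    obtain ⟨k, hk, rfl⟩ := Finset.mem_image.1 hx
    obtain ⟨v, hv, hvk⟩ := setup.pendant_singleton k hk
    have hmem : v ∈ Vset k := by simp [hvk]
    have hk' : k ∈ Finset.Icc 1 t := by
      rw [Finset.mem_Icc] at hk ⊢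
      lia
    refine Finset.mem_image.2 ⟨v, ?_, setup.color_on_class k hk' v hmem⟩
    refine Finset.mem_sdiff.2 ⟨by simpa [P] using hv, fun hv' => ?_⟩
    obtain ⟨l, hl, hvl⟩ := Finset.mem_biUnion.1 (Finset.mem_filter.1 hv').1
    rw [Finset.mem_Icc] at hk hl
    have := setup.r_le_t
    have := setup.index_eq hk' (Finset.mem_Icc.2 ⟨hl.1, by lia⟩) hmem hvl rfl
    lia
  have hinj : Set.InjOn c (Finset.Icc (r + 1) t) := by
    intro k hk l hl hkl
    by_contra hne
    simp only [Finset.coe_Icc, Set.mem_Icc] at hk hl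
    exact setup.color_injective k (by simp; lia) l (by simp; lia) hne hkl
  have h₁ := (Finset.card_le_card hhigh).trans Finset.card_image_le
  rw [Finset.card_image_of_injOn hinj, Nat.card_Icc] at h₁
  have h₂ := Finset.card_sdiff_add_card_eq_card hlow
  change low.card + (t - r) ≤ P.card
  lia

theorem card_pendant_notMem_class (setup : StandardSetup G f t r Vset c) {i : ℕ}
    (hi : i ∈ Finset.Icc 1 t) :
    pendantCount G ≤
      (Finset.univ.filter (fun v => IsPendant G v ∧ v ∉ Vset i)).card + 1 := by
  have h := Finset.card_filter_add_card_filter_not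
    (s := Finset.univ.filter (fun v => IsPendant G v)) (fun v => v ∈ Vset i)
  rw [Finset.filter_filter, Finset.filter_filter] at h
  have h₁ : (Finset.univ.filter (fun v => IsPendant G v ∧ v ∈ Vset i)).card ≤ 1 := by
    refine Finset.card_le_one.2 fun u hu v hv => ?_
    simp only [Finset.mem_filter, Finset.mem_univ, true_and] at hu hv
    refine setup.antimagic.injOn_vertexSum_pendant hu.1 hv.1 ?_
    rw [setup.color_on_class i hi u hu.2, setup.color_on_class i hi v hv.2]
  unfold pendantCount
  lia

end StandardSetup

end StandardSetup

/-- Theorem 2.1(3)(a): in the standard setup with `r ≥ 2`, if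
`c_{j-1} ≤ e < c_j` for some `3 ≤ j ≤ r`, and `1 ≤ i ≤ j - 1` with `e + s·nᵢ ≥ c_r`,
where `s ≥ 1` if `nᵢ = 1` and `s ≥ 2` is even if `nᵢ ≥ 2`, and `Vᵢ` contains a pendant
vertex, then `s·nᵢ + t - r + b ≤ χ_la(G(Vᵢ, s)) ≤ s·nᵢ + t - r + j - 1`. -/
theorem chiLA_attachPendants_bounds_pendant_class [Fintype V] (G : SimpleGraph V)
    (f : Sym2 V → ℕ) (t r : ℕ) (Vset : ℕ → Finset V) (c : ℕ → ℕ)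
    (setup : StandardSetup G f t r Vset c) (hr : 2 ≤ r)
    (e s i j b : ℕ) (he : G.edgeFinset.card = e)
    (hb : pendantsInLow G Vset r = b)
    (hj₁ : 3 ≤ j) (hj₂ : j ≤ r)
    (hce₁ : c (j - 1) ≤ e) (hce₂ : e < c j)
    (hi₁ : 1 ≤ i) (hi₂ : i ≤ j - 1)
    (hbig : c r ≤ e + s * (Vset i).card)
    (hs₁ : (Vset i).card = 1 → 1 ≤ s)
    (hs₂ : 2 ≤ (Vset i).card → 2 ≤ s ∧ Even s)
    (hpend : ∃ v ∈ Vset i, IsPendant G v) :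
    s * (Vset i).card + (t - r) + b ≤ chiLA (attachPendants G (Vset i) s) ∧
    chiLA (attachPendants G (Vset i) s) ≤ s * (Vset i).card + (t - r) + (j - 1) := by
  subst he hb
  have hrt := setup.r_le_t
  have hit : i ∈ Finset.Icc 1 t := Finset.mem_Icc.2 ⟨hi₁, by lia⟩
  obtain ⟨v₀, hv₀, hv₀p⟩ := hpend
  have hci : 1 ≤ c i := by
    rw [← setup.color_on_class i hit v₀ hv₀]
    exact (setup.antimagic.vertexSum_pendant_mem hv₀p).1
  have hn : 1 ≤ (Vset i).card := Finset.card_pos.2 ⟨v₀, hv₀⟩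
  have hs : 1 ≤ s := by
    rcases hn.eq_or_lt with h | h
    · exact hs₁ h.symm
    · have := (hs₂ h).1
      lia
  have hm : 1 ≤ s * (Vset i).card := Nat.mul_pos hs hn
  obtain ⟨L, hL, hrow⟩ := exists_bijOn_constant_row_sum (Vset i) s G.edgeFinset.card
    (hn.eq_or_lt.imp Eq.symm fun h => (hs₂ h).2)
  obtain ⟨C, hC⟩ : ∃ C, ∀ w, ∑ k, L (w, k) = C := ⟨_, fun w => hrow w (⟨v₀, hv₀⟩ : Vset i)⟩
  have hcC : G.edgeFinset.card + s * (Vset i).card < c i + C := by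
    obtain ⟨⟨w, k⟩, -, hk⟩ := hL.surjOn (a := G.edgeFinset.card + s * (Vset i).card)
      (Set.right_mem_Icc.2 (by lia))
    have := Finset.single_le_sum (f := fun k => L (w, k)) (fun _ _ => Nat.zero_le _)
      (Finset.mem_univ k)
    rw [hC] at this
    lia
  have hout : ∀ v ∉ Vset i, ∃ k ∈ Finset.Icc 1 t, k ≠ i ∧ vertexSum G f v = c k := by
    intro v hv
    obtain ⟨k, hk, hvk⟩ := setup.class_cover v
    exact ⟨k, hk, by rintro rfl; exact hv hvk, setup.color_on_class k hk v hvk⟩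
  have hf' := setup.antimagic.extendLabeling hL hC (setup.color_on_class i hit) hcC (by
    intro v hv
    obtain ⟨k, hk, -, hvk⟩ := hout v hv
    rw [hvk]
    rw [Finset.mem_Icc] at hk
    by_cases hkr : k ≤ r
    · exact (setup.color_le (Finset.mem_Icc.2 ⟨hk.1, hkr⟩)).trans hbig
    · exact (setup.color_high_le (Finset.mem_Icc.2 ⟨by lia, hk.2⟩)).trans (Nat.le_add_right _ _))
  constructor
  · obtain ⟨g, hg, hgc⟩ := Nat.sInf_mem (s := {n | ∃ g, IsLocalAntimagic
      (attachPendants G (Vset i) s) g ∧ colorCount (attachPendants G (Vset i) s) g = n})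
      ⟨_, _, hf', rfl⟩
    have hedge : 1 ≤ (attachPendants G (Vset i) s).edgeFinset.card := by
      refine Finset.card_pos.2 ⟨s(Sum.inl v₀, Sum.inr (⟨v₀, hv₀⟩, ⟨0, hs⟩)), ?_⟩
      simp
    have h₁ := hg.pendantCount_lt_colorCount hedge
    have h₂ := le_pendantCount_attachPendants G (Vset i) s
    have h₃ := setup.card_pendant_notMem_class hit
    have h₄ := setup.pendantsInLow_add_le_pendantCount
    unfold chiLA
    lia
  · refine le_trans (b := colorCount _ (extendLabeling f L)) (Nat.sInf_le ⟨_, hf', rfl⟩) ?_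
    have hsub : Finset.univ.image (vertexSum (attachPendants G (Vset i) s) (extendLabeling f L)) ⊆
        Finset.Icc (G.edgeFinset.card + 1) (G.edgeFinset.card + s * (Vset i).card) ∪
          (insert (c i + C) (((Finset.Icc 1 (j - 1)).erase i).image c) ∪
            (Finset.Icc (r + 1) t).image c) := by
      intro x hx
      obtain ⟨y, -, rfl⟩ := Finset.mem_image.1 hx
      rcases y with v | p
      · by_cases hv : v ∈ Vset i
        · rw [vertexSum_extendLabeling_of_mem f L hv, hC, setup.color_on_class i hit v hv]
          simp
        · rw [vertexSum_extendLabeling_of_notMem f L hv]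
          obtain ⟨k, hk, hki, hvk⟩ := hout v hv
          rw [hvk]
          rw [Finset.mem_Icc] at hk
          rcases lt_or_ge k j with hkj | hkj
          · refine Finset.mem_union_right _ (Finset.mem_union_left _ (Finset.mem_insert_of_mem
              (Finset.mem_image_of_mem c (Finset.mem_erase.2 ⟨hki, ?_⟩))))
            exact Finset.mem_Icc.2 ⟨hk.1, by lia⟩
          · rcases le_or_gt k r with hkr | hkr
            · refine Finset.mem_union_left _ (Finset.mem_Icc.2 ⟨?_, ?_⟩)
              · rcases hkj.eq_or_lt with rfl | h
                · exact hce₂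
                · exact hce₂.trans (setup.c_strictMono_low j k (by lia) h hkr)
              · exact (setup.color_le (Finset.mem_Icc.2 ⟨hk.1, hkr⟩)).trans hbig
            · exact Finset.mem_union_right _ (Finset.mem_union_right _
                (Finset.mem_image_of_mem c (Finset.mem_Icc.2 ⟨hkr, hk.2⟩)))
      · rw [vertexSum_attachPendants_inr, extendLabeling_inr_inl]
        refine Finset.mem_union_left _ ?_
        simpa using hL.mapsTo (Set.mem_univ p)
    have h₁ := (Finset.card_le_card hsub).trans (Finset.card_union_le _ _)
    have h₂ := Finset.card_union_le (insert (c i + C) (((Finset.Icc 1 (j - 1)).erase i).image c))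
      ((Finset.Icc (r + 1) t).image c)
    have h₃ := Finset.card_insert_le (c i + C) (((Finset.Icc 1 (j - 1)).erase i).image c)
    have h₄ := Finset.card_image_le (s := (Finset.Icc 1 (j - 1)).erase i) (f := c)
    have h₅ := Finset.card_image_le (s := Finset.Icc (r + 1) t) (f := c)
    rw [Finset.card_erase_of_mem (Finset.mem_Icc.2 ⟨hi₁, hi₂⟩), Nat.card_Icc] at h₄
    rw [Nat.card_Icc] at h₅ h₁
    unfold colorCount
    lia

end LocalAntimagic
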